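/- Let 0 < c < 1, s = cn, and let Y_n be the number of uniform s-subset draws needed to collect all n coupons. With k(n) = ⌊log_{1/(1−c)} n⌋, α(n) = {log_{1/(1−c)} n}, and g(x) = ∑_{i=1}^∞ (1 − e^{−(1−c)^{i−x−1}} − e^{−(1−c)^{−i−x}}), one has E[Y_n] = k(n) + g(α(n)) + o(1) as n → ∞. -/

import Mathlib

open Finset Filter
open scoped Classical

noncomputable section

/-- All tuples of `i` draws, each draw being an `s`-element subset of the `n` coupons.
The drawing process is uniform on this finite set. -/
def draws (n s i : ℕ) : Finset (Fin i → Finset (Fin n)) :=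
  Finset.univ.filter (fun f => ∀ j, (f j).card = s)

/-- The probability, under `i` independent uniform `s`-subset draws from `n` coupons,
of the event `p`. -/
def pr (n s i : ℕ) (p : (Fin i → Finset (Fin n)) → Prop) : ℝ :=
  (((draws n s i).filter p).card : ℝ) / ((draws n s i).card : ℝ)

/-- The event that every coupon has appeared in at least one of the draws. -/
def collected {n i : ℕ} (f : Fin i → Finset (Fin n)) : Prop :=
  ∀ t : Fin n, ∃ j, t ∈ f j

/-- The number of coupons missed by all the draws. -/
def missed {n i : ℕ} (f : Fin i → Finset (Fin n)) : ℕ :=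
  (Finset.univ.filter (fun t : Fin n => ∀ j, t ∉ f j)).card

/-- `P(Y ≥ i)`: the probability that the collection is not complete after `i − 1` draws,
where `Y` is the number of draws needed to collect all `n` coupons. -/
def PYge (n s i : ℕ) : ℝ := pr n s (i - 1) (fun f => ¬ collected f)

/-- `P(Y ≤ i)`: the probability that the collection is complete after `i` draws. -/
def PYle (n s i : ℕ) : ℝ := pr n s i (fun f => collected f)

/-- `P(Y = i)`. -/
def PYeq (n s i : ℕ) : ℝ := PYle n s i - if i = 0 then 0 else PYle n s (i - 1)

/-- `E[Y]`, via the tail-sum formula `E[Y] = ∑_{i≥1} P(Y ≥ i) = ∑_{i≥0} P(Y > i)`. -/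
def EY (n s : ℕ) : ℝ := ∑' i : ℕ, pr n s i (fun f => ¬ collected f)

end

/-- `g(x) = ∑_{i=1}^∞ (1 − e^{−(1−c)^{i−x−1}} − e^{−(1−c)^{−i−x}})`. -/
noncomputable def g (c x : ℝ) : ℝ :=
  ∑' i : ℕ, (1 - Real.exp (-(1 - c) ^ (((i : ℝ) + 1) - x - 1))
               - Real.exp (-(1 - c) ^ (-((i : ℝ) + 1) - x)))

lemma cc_draws_eq (n s i : ℕ) :
    draws n s i = Fintype.piFinset (fun _ : Fin i => Finset.powersetCard s (Finset.univ : Finset (Fin n))) := by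
  ext f
  simp [draws, Fintype.mem_piFinset, Finset.mem_powersetCard]

lemma cc_card_draws (n s i : ℕ) : (draws n s i).card = (n.choose s) ^ i := by
  rw [cc_draws_eq, Fintype.card_piFinset]
  simp

lemma cc_collected_iff {n i : ℕ} (f : Fin i → Finset (Fin n)) : collected f ↔ missed f = 0 := by
  unfold collected missed
  rw [Finset.card_eq_zero, Finset.filter_eq_empty_iff]
  simp

lemma cc_missed_le {n i : ℕ} (f : Fin i → Finset (Fin n)) : missed f ≤ n := by
  unfold missed
  exact (Finset.card_le_univ _).trans (by simp)

lemma cc_sum_choose (n s i r : ℕ) :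
    ∑ f ∈ draws n s i, (missed f).choose r = n.choose r * ((n - r).choose s) ^ i := by
  have h1 : ∀ f : Fin i → Finset (Fin n), (missed f).choose r =
      ∑ A ∈ Finset.powersetCard r (Finset.univ : Finset (Fin n)),
        if (∀ j, f j ⊆ Aᶜ) then 1 else 0 := by
    intro f
    rw [missed, ← Finset.card_powersetCard, ← Finset.card_filter]
    congr 1
    ext A
    simp only [Finset.mem_powersetCard, Finset.mem_filter, Finset.subset_univ, true_and]
    constructor
    · rintro ⟨h, hr⟩
      refine ⟨hr, fun j x hx => ?_⟩
      rw [Finset.mem_compl]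
      intro hA
      have := h hA
      simp at this
      exact this j hx
    · rintro ⟨hr, h⟩
      refine ⟨fun x hx => ?_, hr⟩
      simp
      intro j hj
      have := h j hj
      simp at this
      exact this hx
  simp_rw [h1]
  rw [Finset.sum_comm]
  have h2 : ∀ A ∈ Finset.powersetCard r (Finset.univ : Finset (Fin n)),
      (∑ f ∈ draws n s i, if (∀ j, f j ⊆ Aᶜ) then 1 else 0) = ((n - r).choose s) ^ i := by
    intro A hA
    rw [← Finset.card_filter]
    have : (draws n s i).filter (fun f => ∀ j, f j ⊆ Aᶜ) =
        Fintype.piFinset (fun _ : Fin i => Finset.powersetCard s Aᶜ) := by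
      ext f
      simp only [draws, Fintype.mem_piFinset, Finset.mem_powersetCard, Finset.mem_filter,
        Finset.mem_univ, true_and]
      exact ⟨fun h j => ⟨h.2 j, h.1 j⟩, fun h => ⟨fun j => (h j).2, fun j => (h j).1⟩⟩
    rw [this, Fintype.card_piFinset]
    simp only [Finset.card_powersetCard, Finset.prod_const, Finset.card_univ, Fintype.card_fin]
    rw [Finset.card_compl, (Finset.mem_powersetCard.1 hA).2, Fintype.card_fin]
  rw [Finset.sum_congr rfl h2]
  simp

/-- binomial moments -/
noncomputable def ccA (n s i r : ℕ) : ℝ :=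
  (n.choose r : ℝ) * (((n - r).choose s : ℝ) / (n.choose s : ℝ)) ^ i

lemma cc_sum_choose_real (n s i r : ℕ) (hs : s ≤ n) :
    (∑ f ∈ draws n s i, ((missed f).choose r : ℝ)) = (draws n s i).card * ccA n s i r := by
  have h := cc_sum_choose n s i r
  have hpos : (0:ℝ) < n.choose s := by exact_mod_cast Nat.choose_pos hs
  have h' : (∑ f ∈ draws n s i, ((missed f).choose r : ℝ)) = n.choose r * ((n - r).choose s : ℝ) ^ i := by
    exact_mod_cast h
  rw [h', cc_card_draws, ccA, div_pow]
  push_cast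
  field_simp

lemma cc_draws_pos (n s i : ℕ) (hs : s ≤ n) : (0:ℝ) < (draws n s i).card := by
  rw [cc_card_draws]
  exact_mod_cast pow_pos (Nat.choose_pos hs) i

lemma cc_pr_not (n s i : ℕ) (hs : s ≤ n) :
    pr n s i (fun f => ¬ collected f) = 1 - pr n s i (fun f => collected f) := by
  have hpos := cc_draws_pos n s i hs
  unfold pr
  rw [eq_sub_iff_add_eq, ← add_div, div_eq_one_iff_eq hpos.ne', add_comm]
  have h := Finset.card_filter_add_card_filter_not (s := draws n s i) (fun f => collected f)
  rw [← Nat.cast_add, Nat.cast_inj]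
  convert h

lemma cc_pr_nonneg (n s i : ℕ) (p) : 0 ≤ pr n s i p := by
  unfold pr; positivity

lemma cc_incl_excl (n s i : ℕ) (hs : s ≤ n) :
    pr n s i (fun f => collected f) = ∑' r : ℕ, (-1 : ℝ) ^ r * ccA n s i r := by
  have hpos := cc_draws_pos n s i hs
  rw [tsum_eq_sum (s := Finset.range (n + 1))]
  swap
  · intro r hr
    have : n < r := by simpa using hr
    simp [ccA, Nat.choose_eq_zero_of_lt this]
  unfold pr
  rw [div_eq_iff hpos.ne', Finset.sum_mul]
  have : ∀ r, (-1 : ℝ) ^ r * ccA n s i r * (draws n s i).card =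
      ∑ f ∈ draws n s i, (-1 : ℝ) ^ r * ((missed f).choose r : ℝ) := by
    intro r
    rw [← Finset.mul_sum, cc_sum_choose_real n s i r hs]; ring
  simp_rw [this]
  rw [Finset.sum_comm, Finset.card_filter]
  push_cast
  refine Finset.sum_congr rfl fun f _ => ?_
  have h1 : ∑ r ∈ Finset.range (n + 1), (-1 : ℝ) ^ r * ((missed f).choose r : ℝ) =
      ∑ r ∈ Finset.range (missed f + 1), (-1 : ℝ) ^ r * ((missed f).choose r : ℝ) := by
    symm
    apply Finset.sum_subset
    · intro x hx
      have := cc_missed_le f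
      simp at hx ⊢; omega
    · intro x _ hx
      have : missed f < x := by simpa using hx
      simp [Nat.choose_eq_zero_of_lt this]
  have h2 := Int.alternating_sum_range_choose (n := missed f)
  have h3 : ∑ r ∈ Finset.range (missed f + 1), (-1 : ℝ) ^ r * ((missed f).choose r : ℝ) =
     if missed f = 0 then 1 else 0 := by exact_mod_cast h2
  rw [h1, h3]
  simp [cc_collected_iff]

lemma cc_ratio_step (n s m : ℕ) (q : ℝ) (hn : 0 < n) (hs : s ≤ n) (hq : (n : ℝ) - s = q * n)
    (hm : m + 1 ≤ n) :
    ((m.choose s : ℕ) : ℝ) ≤ q * ((m + 1).choose s : ℕ) := by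
  have hq0 : 0 ≤ q := by
    have : (0:ℝ) ≤ n - s := by simpa using (by exact_mod_cast hs : (s:ℝ) ≤ n)
    have hn' : (0:ℝ) < n := by exact_mod_cast hn
    rw [hq] at this
    exact nonneg_of_mul_nonneg_left this hn'
  rcases le_or_gt s (m) with h | h
  · have e1 : (m+1) * m.choose s = (m+1).choose s * (m + 1 - s) := by
      exact (Nat.choose_mul_succ_eq m s) ▸ (by ring)
    have e2 : ((m:ℝ)+1) * m.choose s = (m+1).choose s * ((m:ℝ) + 1 - s) := by
      have := congrArg (Nat.cast : ℕ → ℝ) e1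
      push_cast [Nat.cast_sub (show s ≤ m + 1 by omega)] at this
      exact this
    have hm' : (m:ℝ) + 1 ≤ n := by exact_mod_cast hm
    have hn' : (0:ℝ) < n := by exact_mod_cast hn
    have key : (m:ℝ) + 1 - s ≤ q * (m + 1) := by
      have hs0 : (0:ℝ) ≤ s := by positivity
      have : q ≤ 1 := by
        have : q * n ≤ 1 * n := by rw [← hq]; linarith
        exact le_of_mul_le_mul_right this hn'
      nlinarith
    have hc : (0:ℝ) ≤ (m+1).choose s := by positivity
    have : ((m:ℝ)+1) * m.choose s ≤ ((m:ℝ)+1) * (q * (m+1).choose s) := by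
      rw [e2]; nlinarith [mul_le_mul_of_nonneg_left key hc]
    exact le_of_mul_le_mul_left this (by positivity)
  · rw [Nat.choose_eq_zero_of_lt h]
    simp only [Nat.cast_zero]
    positivity

lemma cc_q_nonneg (n s : ℕ) (q : ℝ) (hn : 0 < n) (hs : s ≤ n) (hq : (n : ℝ) - s = q * n) : 0 ≤ q := by
  have : (0:ℝ) ≤ n - s := by simpa using (by exact_mod_cast hs : (s:ℝ) ≤ n)
  have hn' : (0:ℝ) < n := by exact_mod_cast hn
  rw [hq] at this
  exact nonneg_of_mul_nonneg_left this hn'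

lemma cc_ratio_le (n s r : ℕ) (q : ℝ) (hn : 0 < n) (hs : s ≤ n) (hq : (n : ℝ) - s = q * n)
    (hr : r ≤ n) : (((n - r).choose s : ℕ) : ℝ) ≤ q ^ r * (n.choose s : ℕ) := by
  have hq0 := cc_q_nonneg n s q hn hs hq
  induction r with
  | zero => simp
  | succ r ih =>
    have h := cc_ratio_step n s (n - (r+1)) q hn hs hq (by omega)
    rw [show n - (r+1) + 1 = n - r by omega] at h
    calc _ ≤ _ := h
      _ ≤ q * (q ^ r * (n.choose s : ℕ)) := by gcongr; exact ih (by omega)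
      _ = _ := by ring

lemma ccA_nonneg (n s i r : ℕ) : 0 ≤ ccA n s i r := by unfold ccA; positivity

lemma ccA_le (n s i r : ℕ) (q : ℝ) (hn : 0 < n) (hs : s ≤ n) (hq : (n : ℝ) - s = q * n) :
    ccA n s i r ≤ (n * q ^ i) ^ r / (r.factorial : ℝ) := by
  have hq0 := cc_q_nonneg n s q hn hs hq
  have hpos : (0:ℝ) < n.choose s := by exact_mod_cast Nat.choose_pos hs
  rcases le_or_gt r n with h | h
  · unfold ccA
    have h1 : (((n - r).choose s : ℝ) / (n.choose s : ℝ)) ≤ q ^ r := by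
      rw [div_le_iff₀ hpos]; exact cc_ratio_le n s r q hn hs hq h
    calc _ ≤ ((n:ℝ) ^ r / (r.factorial : ℝ)) * (q ^ r) ^ i := by
          gcongr
          exact Nat.choose_le_pow_div r n
      _ = _ := by rw [mul_pow, ← pow_mul, ← pow_mul]; ring
  · simp only [ccA, Nat.choose_eq_zero_of_lt h, Nat.cast_zero, zero_mul]
    positivity

lemma ccA_zero (n s i : ℕ) (hs : s ≤ n) : ccA n s i 0 = 1 := by
  have hpos : (0:ℝ) < n.choose s := by exact_mod_cast Nat.choose_pos hs
  simp [ccA, div_self hpos.ne']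

lemma ccA_one (n s i : ℕ) (q : ℝ) (hn : 0 < n) (hs : s ≤ n) (hq : (n : ℝ) - s = q * n) :
    ccA n s i 1 = n * q ^ i := by
  have hpos : (0:ℝ) < n.choose s := by exact_mod_cast Nat.choose_pos hs
  have hn' : (0:ℝ) < n := by exact_mod_cast hn
  unfold ccA
  rw [Nat.choose_one_right]
  congr 2
  rw [div_eq_iff hpos.ne']
  obtain ⟨m, rfl⟩ : ∃ m, n = m + 1 := ⟨n - 1, by omega⟩
  have e1 : (m+1) * m.choose s = (m+1).choose s * (m + 1 - s) := by
      exact (Nat.choose_mul_succ_eq m s) ▸ (by ring)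
  have e2 : ((m:ℝ)+1) * m.choose s = (m+1).choose s * ((m:ℝ) + 1 - s) := by
      have := congrArg (Nat.cast : ℕ → ℝ) e1
      push_cast [Nat.cast_sub hs] at this
      exact this
  push_cast at hq hn'
  rw [hq] at e2
  simp only [Nat.add_sub_cancel]
  have : ((m:ℝ)+1) * m.choose s = ((m:ℝ)+1) * (q * (m+1).choose s) := by rw [e2]; ring
  exact mul_left_cancel₀ hn'.ne' this

/-- union bound -/
lemma cc_union (n s i : ℕ) (q : ℝ) (hn : 0 < n) (hs : s ≤ n) (hq : (n : ℝ) - s = q * n) :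
    pr n s i (fun f => ¬ collected f) ≤ n * q ^ i := by
  have hpos := cc_draws_pos n s i hs
  unfold pr
  rw [div_le_iff₀ hpos, ← ccA_one n s i q hn hs hq, mul_comm, ← cc_sum_choose_real n s i 1 hs,
    Finset.card_filter]
  push_cast
  refine Finset.sum_le_sum fun f _ => ?_
  simp only [cc_collected_iff, Nat.choose_one_right]
  by_cases h : missed f = 0
  · simp [h]
  · simp only [h, not_false_eq_true, if_true]
    exact_mod_cast Nat.one_le_iff_ne_zero.2 h

/-- Chebyshev -/
lemma cc_cheb (n s i : ℕ) (q : ℝ) (hn : 0 < n) (hs : s ≤ n) (hq : (n : ℝ) - s = q * n)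
    (hq0 : 0 < q) :
    pr n s i (fun f => collected f) ≤ 1 / (n * q ^ i) := by
  have hpos := cc_draws_pos n s i hs
  have hn' : (0:ℝ) < n := by exact_mod_cast hn
  set t : ℝ := n * q ^ i with ht
  have htpos : 0 < t := by positivity
  have e1 := cc_sum_choose_real n s i 1 hs
  have e2 := cc_sum_choose_real n s i 2 hs
  rw [ccA_one n s i q hn hs hq, ← ht] at e1
  have a2 := ccA_le n s i 2 q hn hs hq
  rw [← ht] at a2
  simp only [Nat.choose_one_right] at e1
  simp only [Nat.cast_choose_two] at e2
  have b : (t ^ 2) * (((draws n s i).filter (fun f => collected f)).card : ℝ) ≤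
      ∑ f ∈ draws n s i, ((missed f : ℝ) - t) ^ 2 := by
    rw [Finset.card_filter]
    push_cast
    rw [Finset.mul_sum]
    refine Finset.sum_le_sum fun f _ => ?_
    simp only [cc_collected_iff]
    split_ifs with h
    · simp [h]
    · simp; positivity
  have c : ∑ f ∈ draws n s i, ((missed f : ℝ) - t) ^ 2 =
      2 * (∑ f ∈ draws n s i, (missed f : ℝ) * ((missed f : ℝ) - 1) / 2)
      + (1 - 2 * t) * (∑ f ∈ draws n s i, (missed f : ℝ)) + (draws n s i).card * t ^ 2 := by
    rw [Finset.mul_sum, Finset.mul_sum, ← Finset.sum_add_distrib, ← nsmul_eq_mul,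
      ← Finset.sum_const, ← Finset.sum_add_distrib]
    refine Finset.sum_congr rfl fun f _ => ?_
    ring
  rw [c, e1, e2] at b
  unfold pr
  rw [div_le_div_iff₀ hpos htpos]
  have a3 : ccA n s i 2 ≤ t ^ 2 / 2 := by simpa using a2
  have : t * ((((draws n s i).filter (fun f => collected f)).card : ℝ) * t) ≤
      t * (1 * (draws n s i).card) := by
    nlinarith [mul_le_mul_of_nonneg_left a3 hpos.le]
  exact le_of_mul_le_mul_left this htpos

lemma cc_mul_zero {x y : ℕ → ℝ} {B : ℝ} (hx : Tendsto x atTop (nhds 0))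
    (hy : ∀ᶠ j in atTop, |y j| ≤ B) : Tendsto (fun j => x j * y j) atTop (nhds 0) := by
  have h := (hx.abs).mul_const B
  simp only [abs_zero, zero_mul] at h
  refine squeeze_zero_norm' ?_ h
  filter_upwards [hy] with j hj
  rw [Real.norm_eq_abs, abs_mul]
  gcongr

lemma cc_factor (n r i : ℕ) (q : ℝ) (hq : 0 < q) (hq1 : q ≤ 1) (hn : 0 < n) (h2 : 2 * r ≤ n)
    (h3 : (r : ℝ) ≤ q * n) :
    |((n:ℝ) - r) * ((q * n - r) / (n - r)) ^ i - n * q ^ i| ≤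
      n * q ^ i * (r / n + (2 * r / q) * (i / n)) := by
  have hn' : (0:ℝ) < n := by exact_mod_cast hn
  have h2' : 2 * (r:ℝ) ≤ n := by exact_mod_cast h2
  have hr0 : (0:ℝ) ≤ r := by positivity
  have hnr : (0:ℝ) < n - r := by linarith
  set x : ℝ := r * (1 - q) / ((n - r) * q) with hx
  have hw : (q * n - r) / ((n:ℝ) - r) = q * (1 - x) := by
    rw [hx]; field_simp; ring
  have hx0 : 0 ≤ x := by
    rw [hx]; have : 0 ≤ 1 - q := by linarith
    positivity
  have hx1 : x ≤ 1 := by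
    rw [hx, div_le_one (by positivity)]; nlinarith
  have hx2 : x ≤ 2 * r / q / n := by
    rw [hx, div_div, div_le_div_iff₀ (by positivity) (by positivity)]
    have : (1 - q) * n ≤ 2 * (n - r) := by nlinarith
    have := mul_le_mul_of_nonneg_left this (mul_nonneg hr0 hq.le)
    nlinarith
  have hb : 1 - i * x ≤ (1 - x) ^ i := by
    have := one_add_mul_le_pow (a := -x) (by linarith) i
    rw [← sub_eq_add_neg] at this
    linarith
  have hb1 : (1 - x) ^ i ≤ 1 := pow_le_one₀ (by linarith) (by linarith)
  have hb0 : 0 ≤ (1 - x) ^ i := pow_nonneg (by linarith) _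
  have hi0 : (0:ℝ) ≤ i := by positivity
  have e : ((n:ℝ) - r) * ((q * n - r) / (n - r)) ^ i - n * q ^ i =
      - (n * q ^ i * (1 - (1 - r / n) * (1 - x) ^ i)) := by
    rw [hw, mul_pow]; field_simp; ring
  have hrn : (r:ℝ) / n ≤ 1 := by rw [div_le_one hn']; linarith
  have hrn0 : 0 ≤ (r:ℝ) / n := by positivity
  rw [e, abs_neg, abs_mul, abs_of_nonneg (by positivity : 0 ≤ (n:ℝ) * q ^ i)]
  gcongr
  have hix : i * x ≤ 2 * r / q * (i / n) := by
    calc i * x ≤ i * (2 * r / q / n) := by gcongr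
      _ = _ := by ring
  rw [abs_le]
  constructor
  · have : 0 ≤ 2 * r / q * ((i:ℝ) / n) := by positivity
    nlinarith
  · nlinarith

lemma ccA_succ (n s i r : ℕ) (q : ℝ) (hs : s ≤ n) (hq : (n : ℝ) - s = q * n) (hr : r < n)
    (h3 : (r : ℝ) ≤ q * n) :
    ccA n s i (r + 1) = ccA n s i r * (((n:ℝ) - r) * ((q * n - r) / (n - r)) ^ i) / (r + 1) := by
  have hpos : (0:ℝ) < n.choose s := by exact_mod_cast Nat.choose_pos hs
  have hr' : (r:ℝ) < n := by exact_mod_cast hr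
  have hnr : (0:ℝ) < n - r := by linarith
  have f1 : (n.choose (r+1) : ℝ) * (r + 1) = n.choose r * ((n:ℝ) - r) := by
    have := congrArg (Nat.cast : ℕ → ℝ) (Nat.choose_succ_right_eq n r)
    push_cast [Nat.cast_sub hr.le] at this
    exact this
  have hsr : s + r ≤ n := by
    have : (s:ℝ) + r ≤ n := by linarith
    exact_mod_cast this
  have f2 : ((n - (r+1)).choose s : ℝ) * ((n:ℝ) - r) = (n - r).choose s * (q * n - r) := by
    have e := Nat.choose_mul_succ_eq (n - (r+1)) s
    rw [show n - (r+1) + 1 = n - r by omega] at e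
    have := congrArg (Nat.cast : ℕ → ℝ) e
    push_cast [Nat.cast_sub (show s ≤ n - r by omega), Nat.cast_sub hr.le] at this
    rw [← hq]
    rw [this]; ring
  have f3 : ((n - (r+1)).choose s : ℝ) = (n - r).choose s * ((q * n - r) / (n - r)) := by
    field_simp; exact f2
  have f4 : (n.choose (r+1) : ℝ) = n.choose r * ((n:ℝ) - r) / (r + 1) := by
    field_simp; exact f1
  unfold ccA
  rw [f3, f4, mul_div_right_comm ((n - r).choose s : ℝ), mul_pow]
  ring

lemma cc_A_tendsto (q : ℝ) (hq : 0 < q) (hq1 : q ≤ 1) (n s i : ℕ → ℕ) (T : ℝ)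
    (hn : Tendsto n atTop atTop) (hs : ∀ j, s j ≤ n j)
    (hqs : ∀ j, (n j : ℝ) - s j = q * n j)
    (hT : ∀ᶠ j in atTop, (n j : ℝ) * q ^ i j ≤ T)
    (hi : Tendsto (fun j => (i j : ℝ) / n j) atTop (nhds 0)) (r : ℕ) :
    Tendsto (fun j => ccA (n j) (s j) (i j) r - ((n j : ℝ) * q ^ i j) ^ r / (r.factorial : ℝ))
      atTop (nhds 0) := by
  have hnR : Tendsto (fun j => (n j : ℝ)) atTop atTop := tendsto_natCast_atTop_atTop.comp hn
  induction r with
  | zero =>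
    have : (fun j => ccA (n j) (s j) (i j) 0 - ((n j : ℝ) * q ^ i j) ^ 0 / (Nat.factorial 0 : ℝ))
        = fun _ => 0 := by
      funext j; simp [ccA_zero _ _ _ (hs j)]
    rw [this]; exact tendsto_const_nhds
  | succ r ih =>
    set v : ℕ → ℝ := fun j => ((n j:ℝ) - r) * ((q * n j - r) / (n j - r)) ^ i j with hv
    set t : ℕ → ℝ := fun j => (n j : ℝ) * q ^ i j with ht
    have ht0 : ∀ j, 0 ≤ t j := fun j => by positivity
    have htB : ∀ᶠ j in atTop, |t j| ≤ T := by
      filter_upwards [hT] with j hj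
      rw [abs_of_nonneg (ht0 j)]; exact hj
    have hbig : ∀ᶠ j in atTop, 0 < n j ∧ 2 * r ≤ n j ∧ (r:ℝ) ≤ q * n j ∧ r < n j := by
      filter_upwards [hn.eventually_ge_atTop (2 * r + 1),
        (hnR.const_mul_atTop hq).eventually_ge_atTop (r:ℝ)] with j h1 h2
      exact ⟨by omega, by omega, h2, by omega⟩
    have hvt : Tendsto (fun j => v j - t j) atTop (nhds 0) := by
      have h0 : Tendsto (fun j => (r / (n j : ℝ) + (2 * r / q) * (i j / n j)) * t j) atTop (nhds 0) := by
        apply cc_mul_zero _ htB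
        have := (hnR.const_div_atTop (r:ℝ)).add (hi.const_mul (2 * r / q))
        simpa using this
      refine squeeze_zero_norm' ?_ h0
      filter_upwards [hbig] with j ⟨h1, h2, h3, _⟩
      rw [Real.norm_eq_abs, mul_comm]
      exact cc_factor (n j) r (i j) q hq hq1 h1 h2 h3
    have htr : ∀ᶠ j in atTop, |t j ^ r / (r.factorial : ℝ)| ≤ T ^ r / (r.factorial : ℝ) := by
      filter_upwards [hT] with j hj
      rw [abs_of_nonneg (by have := ht0 j; positivity)]
      have := ht0 j
      gcongr
    have h1 := (((ih.mul hvt).add (cc_mul_zero ih htB)).add (cc_mul_zero hvt htr)).div_const ((r:ℝ)+1)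
    simp only [mul_zero, add_zero, zero_div] at h1
    refine h1.congr' ?_
    filter_upwards [hbig] with j ⟨_, _, h3, h4⟩
    rw [ccA_succ (n j) (s j) (i j) r q (hs j) (hqs j) h4 h3, Nat.factorial_succ]
    change _ = ccA (n j) (s j) (i j) r * v j / (r + 1) - t j ^ (r+1) / _
    change ((ccA (n j) (s j) (i j) r - t j ^ r / _) * (v j - t j) + (ccA (n j) (s j) (i j) r - t j ^ r / _) * t j + (v j - t j) * (t j ^ r / _)) / _ = _
    have : (r.factorial : ℝ) ≠ 0 := by positivity
    push_cast
    field_simp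
    ring

lemma cc_poisson (q : ℝ) (hq : 0 < q) (hq1 : q ≤ 1) (n s i : ℕ → ℕ) (T : ℝ)
    (hn : Tendsto n atTop atTop) (hs : ∀ j, s j ≤ n j)
    (hqs : ∀ j, (n j : ℝ) - s j = q * n j)
    (hT : ∀ᶠ j in atTop, (n j : ℝ) * q ^ i j ≤ T)
    (hi : Tendsto (fun j => (i j : ℝ) / n j) atTop (nhds 0)) :
    Tendsto (fun j => pr (n j) (s j) (i j) (fun f => collected f)
      - Real.exp (-((n j : ℝ) * q ^ i j))) atTop (nhds 0) := by
  have hexp : ∀ x : ℝ, HasSum (fun r : ℕ => x ^ r / (r.factorial : ℝ)) (Real.exp x) := by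
    intro x
    rw [Real.exp_eq_exp_ℝ]
    exact NormedSpace.expSeries_div_hasSum_exp x
  have key := tendsto_tsum_of_dominated_convergence (𝓕 := atTop)
    (f := fun (j r : ℕ) => (-1 : ℝ) ^ r * (ccA (n j) (s j) (i j) r - ((n j : ℝ) * q ^ i j) ^ r / (r.factorial : ℝ)))
    (g := fun _ => 0) (bound := fun r => T ^ r / (r.factorial : ℝ)) (hexp T).summable
    (by
      intro r
      have := (cc_A_tendsto q hq hq1 n s i T hn hs hqs hT hi r).const_mul ((-1:ℝ) ^ r)
      simpa using this)
    (by
      filter_upwards [hT, hn.eventually_gt_atTop 0] with j hj hn0 r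
      have h1 := ccA_le (n j) (s j) (i j) r q hn0 (hs j) (hqs j)
      have h0 := ccA_nonneg (n j) (s j) (i j) r
      have h2 : ((n j : ℝ) * q ^ i j) ^ r / (r.factorial : ℝ) ≤ T ^ r / (r.factorial : ℝ) := by gcongr
      rw [norm_mul, norm_pow, norm_neg, norm_one, one_pow, one_mul, Real.norm_eq_abs, abs_le]
      constructor <;> linarith)
  rw [tsum_zero] at key
  refine key.congr fun j => ?_
  rw [cc_incl_excl _ _ _ (hs j), ← (hexp _).tsum_eq, ← Summable.tsum_sub]
  · refine tsum_congr fun r => ?_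
    rw [neg_pow ((n j : ℝ) * q ^ i j)]; ring
  · apply summable_of_ne_finset_zero (s := Finset.range (n j + 1))
    intro r hr
    have : n j < r := by simpa using hr
    simp [ccA, Nat.choose_eq_zero_of_lt this]
  · exact (hexp _).summable

lemma cc_exp_neg_le {x : ℝ} (hx : 0 < x) : Real.exp (-x) ≤ 1 / x := by
  rw [Real.exp_neg, ← one_div]
  exact one_div_le_one_div_of_le hx (by have := Real.add_one_le_exp x; linarith)

lemma cc_nq (q : ℝ) (hq : 0 < q) (hq1 : q < 1) (n i : ℕ) (hn : 0 < n) :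
    (n : ℝ) * q ^ i = q ^ ((i : ℝ) - Real.logb (1 / q) n) := by
  have hn' : (0:ℝ) < n := by exact_mod_cast hn
  rw [Real.rpow_sub hq, Real.rpow_natCast]
  have : q ^ (Real.logb (1 / q) n) = (n : ℝ)⁻¹ := by
    rw [one_div, Real.logb_inv_base, Real.rpow_neg hq.le, Real.rpow_logb hq hq1.ne hn']
  rw [this]
  field_simp

lemma cc_bnd_one (q α : ℝ) (hq : 0 < q) (hq1 : q < 1) (h0 : 0 ≤ α) (h1 : α < 1) (m : ℕ) :
    q ^ ((m : ℝ) + 1 - α - 1) ≤ q⁻¹ * q ^ m := by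
  have : q⁻¹ * q ^ m = q ^ ((m:ℝ) - 1) := by
    rw [Real.rpow_sub hq, Real.rpow_natCast, Real.rpow_one]; field_simp
  rw [this]
  exact Real.rpow_le_rpow_of_exponent_ge hq hq1.le (by linarith)

lemma cc_bnd_two (q α : ℝ) (hq : 0 < q) (hq1 : q < 1) (h0 : 0 ≤ α) (m : ℕ) :
    1 / q ^ (-((m : ℝ) + 1) - α) ≤ q ^ m := by
  rw [one_div, ← Real.rpow_neg hq.le, ← Real.rpow_natCast q m]
  exact Real.rpow_le_rpow_of_exponent_ge hq hq1.le (by linarith)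

/-- upper-tail differences -/
noncomputable def ccD (q : ℝ) (n s k : ℕ) (α : ℝ) (m : ℕ) : ℝ :=
  pr n s (m + k) (fun f => ¬ collected f) - (1 - Real.exp (-q ^ (((m : ℝ) + 1) - α - 1)))

/-- lower-tail differences -/
noncomputable def ccE (q : ℝ) (n s k : ℕ) (α : ℝ) (m : ℕ) : ℝ :=
  Real.exp (-q ^ (-((m : ℝ) + 1) - α)) -
    (if m < k then pr n s (k - 1 - m) (fun f => collected f) else 0)

lemma cc_nq_one (q : ℝ) (hq : 0 < q) (hq1 : q < 1) (n k : ℕ) (α : ℝ) (hn : 0 < n)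
    (hk : Real.logb (1 / q) n = k + α) (m : ℕ) : (n : ℝ) * q ^ (m + k) = q ^ (((m : ℝ) + 1) - α - 1) := by
  rw [cc_nq q hq hq1 n _ hn, hk]; congr 1; push_cast; ring

lemma cc_nq_two (q : ℝ) (hq : 0 < q) (hq1 : q < 1) (n k : ℕ) (α : ℝ) (hn : 0 < n)
    (hk : Real.logb (1 / q) n = k + α) (m : ℕ) (hm : m < k) : (n : ℝ) * q ^ (k - 1 - m) = q ^ (-((m : ℝ) + 1) - α) := by
  rw [cc_nq q hq hq1 n _ hn, hk, Nat.sub_sub, Nat.cast_sub (by omega)]; congr 1; push_cast; ring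

lemma ccD_bound (q : ℝ) (hq : 0 < q) (hq1 : q < 1) (n s k : ℕ) (α : ℝ) (hn : 0 < n)
    (hs : s ≤ n) (hqs : (n : ℝ) - s = q * n) (h0 : 0 ≤ α) (h1 : α < 1)
    (hk : Real.logb (1 / q) n = k + α) (m : ℕ) : |ccD q n s k α m| ≤ q⁻¹ * q ^ m := by
  have a := cc_union n s (m + k) q hn hs hqs
  rw [cc_nq_one q hq hq1 n k α hn hk m] at a
  have b := cc_bnd_one q α hq hq1 h0 h1 m
  have c := cc_pr_nonneg n s (m + k) (fun f => ¬ collected f)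
  have d := Real.add_one_le_exp (-q ^ (((m : ℝ) + 1) - α - 1))
  have e : Real.exp (-q ^ (((m : ℝ) + 1) - α - 1)) ≤ 1 := by
    rw [Real.exp_le_one_iff, neg_nonpos]; positivity
  unfold ccD
  rw [abs_le]
  constructor <;> linarith

lemma ccE_bound (q : ℝ) (hq : 0 < q) (hq1 : q < 1) (n s k : ℕ) (α : ℝ) (hn : 0 < n)
    (hs : s ≤ n) (hqs : (n : ℝ) - s = q * n) (h0 : 0 ≤ α)
    (hk : Real.logb (1 / q) n = k + α) (m : ℕ) : |ccE q n s k α m| ≤ q ^ m := by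
  have b := cc_bnd_two q α hq hq1 h0 m
  have hx : 0 < q ^ (-((m : ℝ) + 1) - α) := by positivity
  have e := cc_exp_neg_le hx
  have e0 := Real.exp_pos (-q ^ (-((m : ℝ) + 1) - α))
  unfold ccE
  split_ifs with hm
  · have a := cc_cheb n s (k - 1 - m) q hn hs hqs hq
    rw [cc_nq_two q hq hq1 n k α hn hk m hm] at a
    have c := cc_pr_nonneg n s (k - 1 - m) (fun f => collected f)
    rw [abs_le]
    constructor <;> linarith
  · rw [abs_le]
    constructor <;> linarith

lemma cc_main_identity (q : ℝ) (hq : 0 < q) (hq1 : q < 1) (n s k : ℕ) (α : ℝ) (hn : 0 < n)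
    (hs : s ≤ n) (hqs : (n : ℝ) - s = q * n) (h0 : 0 ≤ α) (h1 : α < 1)
    (hk : Real.logb (1 / q) n = k + α) :
    EY n s - ((k : ℝ) + g (1 - q) α) = (∑' m, ccD q n s k α m) + ∑' m, ccE q n s k α m := by
  have hgeo : Summable (fun m : ℕ => q ^ m) := summable_geometric_of_lt_one hq.le hq1
  have sP : Summable (fun i => pr n s i (fun f => ¬ collected f)) :=
    Summable.of_nonneg_of_le (fun i => cc_pr_nonneg _ _ _ _)
      (fun i => cc_union n s i q hn hs hqs) (hgeo.mul_left _)
  have sP' : Summable (fun m => pr n s (m + k) (fun f => ¬ collected f)) :=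
    (summable_nat_add_iff k).2 sP
  have sD : Summable (ccD q n s k α) :=
    Summable.of_norm_bounded (hgeo.mul_left q⁻¹)
      (fun m => ccD_bound q hq hq1 n s k α hn hs hqs h0 h1 hk m)
  have sE : Summable (ccE q n s k α) :=
    Summable.of_norm_bounded hgeo
      (fun m => ccE_bound q hq hq1 n s k α hn hs hqs h0 hk m)
  set P : ℕ → ℝ := fun m => if m < k then pr n s (k - 1 - m) (fun f => collected f) else 0 with hP
  have hP0 : ∀ m ∉ Finset.range k, P m = 0 := by
    intro m hm
    have : ¬ m < k := by simpa using hm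
    simp [hP, this]
  have sPP : Summable P := summable_of_ne_finset_zero hP0
  have tP : ∑' m, P m = ∑ i ∈ Finset.range k, pr n s i (fun f => collected f) := by
    rw [tsum_eq_sum hP0, ← Finset.sum_range_reflect]
    refine Finset.sum_congr rfl fun m hm => ?_
    have : m < k := by simpa using hm
    have e1 : k - 1 - m < k := by omega
    have e2 : k - 1 - (k - 1 - m) = m := by omega
    simp only [hP, if_pos e1]
    rw [e2]
  have hEY : EY n s = (k : ℝ) - (∑' m, P m) + ∑' m, pr n s (m + k) (fun f => ¬ collected f) := by
    unfold EY
    rw [← sP.sum_add_tsum_nat_add k, tP]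
    congr 1
    rw [Finset.sum_congr rfl (fun i _ => cc_pr_not n s i hs), Finset.sum_sub_distrib]
    simp
  have hg : g (1 - q) α = (∑' m, pr n s (m + k) (fun f => ¬ collected f)) - (∑' m, ccD q n s k α m)
      - ((∑' m, ccE q n s k α m) + ∑' m, P m) := by
    rw [← sP'.tsum_sub sD, ← sE.tsum_add sPP, ← (sP'.sub sD).tsum_sub (sE.add sPP)]
    unfold g
    refine tsum_congr fun m => ?_
    simp only [ccD, ccE, hP, sub_sub_cancel]
    ring
  rw [hEY, hg]; ring

/-- Case II: with `s = cn` (along a sequence where `cn` is an integer),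
`E[Y_n] = ⌊log_{1/(1−c)} n⌋ + g({log_{1/(1−c)} n}) + o(1)`. -/
theorem stmt18 (c : ℝ) (hc : 0 < c) (hc1 : c < 1)
    (nj : ℕ → ℕ) (hmono : StrictMono nj) (s : ℕ → ℕ)
    (hs : ∀ j, (s j : ℝ) = c * nj j) :
    Tendsto
      (fun j =>
        EY (nj j) (s j) -
          ((⌊Real.logb (1 / (1 - c)) (nj j)⌋ : ℝ) +
            g c (Int.fract (Real.logb (1 / (1 - c)) (nj j)))))
      atTop (nhds 0) := by
  set q : ℝ := 1 - c with hqdef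
  have hq : 0 < q := by linarith
  have hq1 : q < 1 := by linarith
  have hcq : c = 1 - q := by linarith
  have hn : Tendsto nj atTop atTop := hmono.tendsto_atTop
  have hnR : Tendsto (fun j => (nj j : ℝ)) atTop atTop := tendsto_natCast_atTop_atTop.comp hn
  have hsn : ∀ j, s j ≤ nj j := by
    intro j
    have h : (s j : ℝ) ≤ nj j := by
      rw [hs j]
      have : (0:ℝ) ≤ nj j := by positivity
      nlinarith
    exact_mod_cast h
  have hqs : ∀ j, (nj j : ℝ) - s j = q * nj j := by
    intro j; rw [hs j, hqdef]; ring
  have hb : 1 < 1 / q := by rw [lt_div_iff₀ hq]; linarith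
  set L : ℕ → ℝ := fun j => Real.logb (1 / q) (nj j) with hL
  set k : ℕ → ℕ := fun j => ⌊L j⌋.toNat with hk
  set α : ℕ → ℝ := fun j => Int.fract (L j) with hα
  have hLtop : Tendsto L atTop atTop := (Real.tendsto_logb_atTop hb).comp hnR
  have hfl : ∀ j, 0 < nj j → ((⌊L j⌋ : ℝ)) = k j := by
    intro j hj
    have h1 : (1:ℝ) ≤ nj j := by exact_mod_cast hj
    have : 0 ≤ ⌊L j⌋ := Int.floor_nonneg.2 (Real.logb_nonneg hb h1)
    have h2 : ((⌊L j⌋.toNat : ℤ)) = ⌊L j⌋ := Int.toNat_of_nonneg this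
    exact_mod_cast h2.symm
  have hLk : ∀ j, 0 < nj j → Real.logb (1 / q) (nj j) = k j + α j := by
    intro j hj
    rw [← hfl j hj]
    exact (Int.floor_add_fract (L j)).symm
  have hα0 : ∀ j, 0 ≤ α j := fun j => Int.fract_nonneg _
  have hα1 : ∀ j, α j < 1 := fun j => Int.fract_lt_one _
  have hpos : ∀ᶠ j in atTop, 0 < nj j := hn.eventually_gt_atTop 0
  have hktop : ∀ m : ℕ, ∀ᶠ j in atTop, m < k j := by
    intro m
    filter_upwards [hpos, hLtop.eventually_ge_atTop ((m:ℝ) + 2)] with j h1 h2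
    have h3 := hLk j h1
    have h4 := hα1 j
    have : (m:ℝ) < k j := by
      change (m:ℝ) + 2 ≤ Real.logb (1 / q) (nj j) at h2
      linarith
    exact_mod_cast this
  have hdiv : ∀ (m : ℕ) (i : ℕ → ℕ), (∀ j, i j ≤ m + k j) →
      Tendsto (fun j => (i j : ℝ) / nj j) atTop (nhds 0) := by
    intro m i hi
    have hlog : Tendsto (fun j => L j / (nj j : ℝ)) atTop (nhds 0) := by
      have h1 : Tendsto (fun x : ℝ => Real.log x / x) atTop (nhds 0) :=
        Real.isLittleO_log_id_atTop.tendsto_div_nhds_zero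
      have h2 := (h1.comp hnR).div_const (Real.log (1 / q))
      rw [zero_div] at h2
      refine h2.congr fun j => ?_
      simp only [hL, Real.logb, Function.comp]
      ring
    have h3 := (hnR.const_div_atTop (m:ℝ)).add hlog
    rw [add_zero] at h3
    refine squeeze_zero' (Eventually.of_forall fun j => by positivity) ?_ h3
    filter_upwards [hpos] with j hj
    rw [← add_div]
    have h4 : (i j : ℝ) ≤ m + k j := by exact_mod_cast hi j
    have h5 : L j = k j + α j := hLk j hj
    have h6 := hα0 j
    gcongr
    linarith
  have hgeo : Summable (fun m : ℕ => q ^ m) := summable_geometric_of_lt_one hq.le hq1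
  have hD := tendsto_tsum_of_dominated_convergence (𝓕 := atTop)
    (f := fun j m => ccD q (nj j) (s j) (k j) (α j) m) (g := fun _ => 0)
    (bound := fun m => q⁻¹ * q ^ m) (hgeo.mul_left _)
    (by
      intro m
      have h := (cc_poisson q hq hq1.le nj s (fun j => m + k j) (q⁻¹ * q ^ m) hn hsn hqs
        (by
          filter_upwards [hpos] with j hj
          rw [cc_nq_one q hq hq1 (nj j) (k j) (α j) hj (hLk j hj) m]
          exact cc_bnd_one q (α j) hq hq1 (hα0 j) (hα1 j) m)
        (hdiv m _ (fun j => le_rfl))).neg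
      rw [neg_zero] at h
      refine h.congr' ?_
      filter_upwards [hpos] with j hj
      rw [ccD, cc_pr_not _ _ _ (hsn j), cc_nq_one q hq hq1 (nj j) (k j) (α j) hj (hLk j hj) m]
      ring)
    (by
      filter_upwards [hpos] with j hj m
      exact ccD_bound q hq hq1 (nj j) (s j) (k j) (α j) hj (hsn j) (hqs j) (hα0 j) (hα1 j)
        (hLk j hj) m)
  have hE := tendsto_tsum_of_dominated_convergence (𝓕 := atTop)
    (f := fun j m => ccE q (nj j) (s j) (k j) (α j) m) (g := fun _ => 0)
    (bound := fun m => q ^ m) hgeo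
    (by
      intro m
      have h := (cc_poisson q hq hq1.le nj s (fun j => k j - 1 - m) (q ^ (-((m : ℝ) + 1) - 1))
        hn hsn hqs
        (by
          filter_upwards [hpos, hktop m] with j hj hm
          rw [cc_nq_two q hq hq1 (nj j) (k j) (α j) hj (hLk j hj) m hm]
          have := hα1 j
          exact Real.rpow_le_rpow_of_exponent_ge hq hq1.le (by linarith))
        (hdiv 0 _ (fun j => by omega))).neg
      rw [neg_zero] at h
      refine h.congr' ?_
      filter_upwards [hpos, hktop m] with j hj hm
      rw [ccE, cc_nq_two q hq hq1 (nj j) (k j) (α j) hj (hLk j hj) m hm, if_pos hm]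
      ring)
    (by
      filter_upwards [hpos] with j hj m
      exact ccE_bound q hq hq1 (nj j) (s j) (k j) (α j) hj (hsn j) (hqs j) (hα0 j)
        (hLk j hj) m)
  have hfin := hD.add hE
  rw [tsum_zero, add_zero] at hfin
  refine hfin.congr' ?_
  filter_upwards [hpos] with j hj
  have h := cc_main_identity q hq hq1 (nj j) (s j) (k j) (α j) hj (hsn j) (hqs j) (hα0 j) (hα1 j)
    (hLk j hj)
  rw [← h, ← hfl j hj, ← hcq]
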